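/- Let k ∈ ℝ. There exists a constant C > 0 (depending only on k) such that for all y with 0 < ‖y‖ ≤ 1 and all v ∈ ℝ³: |Dg(y)(v) + ⟨y, v⟩/(4π‖y‖³)| ≤ C·‖v‖/‖y‖; i.e., the gradient of the Helmholtz Green's function equals the static field −u/(4π‖y‖²) (with u = y/‖y‖) up to an error of order O(1/‖y‖) as y → 0. -/

import Mathlib

open MeasureTheory Metric Real RealInnerProductSpace

noncomputable def gHelm (k : ℝ) (y : EuclideanSpace ℝ (Fin 3)) : ℂ :=
  Complex.exp (-Complex.I * k * ‖y‖) / (4 * π * ‖y‖)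

theorem hasFDerivAt_norm_of_ne_zero {E : Type*} [NormedAddCommGroup E] [InnerProductSpace ℝ E]
    {y : E} (hy : y ≠ 0) :
    HasFDerivAt (fun x : E => ‖x‖) (‖y‖⁻¹ • innerSL ℝ y) y := by
  have hy' : ‖y‖ ≠ 0 := norm_ne_zero_iff.mpr hy
  have h := (hasStrictFDerivAt_norm_sq y).hasFDerivAt.sqrt (pow_ne_zero 2 hy')
  simp only [Real.sqrt_sq (norm_nonneg _)] at h
  convert h using 1
  ext v
  simp
  field_simp

theorem hasDerivAt_helmholtz_radial (k : ℝ) {r : ℝ} (hr : r ≠ 0) :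
    HasDerivAt (fun s : ℝ => Complex.exp (-Complex.I * k * s) / (4 * π * s))
      (-(Complex.exp (-Complex.I * k * r) * (1 + Complex.I * k * r)) / (4 * π * r ^ 2)) r := by
  have hr' : (r : ℂ) ≠ 0 := Complex.ofReal_ne_zero.mpr hr
  have hπ : (π : ℂ) ≠ 0 := Complex.ofReal_ne_zero.mpr pi_ne_zero
  have hid : HasDerivAt (fun s : ℝ => (s : ℂ)) 1 r := Complex.ofRealCLM.hasDerivAt
  have h := (hid.const_mul (-Complex.I * k)).cexp.div (hid.const_mul (4 * (π : ℂ)))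
    (mul_ne_zero (mul_ne_zero (by norm_num) hπ) hr')
  refine h.congr_deriv ?_
  field_simp
  ring

theorem fderiv_gHelm_apply (k : ℝ) {y : EuclideanSpace ℝ (Fin 3)} (hy : y ≠ 0)
    (v : EuclideanSpace ℝ (Fin 3)) :
    fderiv ℝ (gHelm k) y v =
      -(((⟪y, v⟫ / (4 * π * ‖y‖ ^ 3) : ℝ) : ℂ) *
        (Complex.exp (-Complex.I * k * ‖y‖) * (1 + Complex.I * k * ‖y‖))) := by
  have hy' : ‖y‖ ≠ 0 := norm_ne_zero_iff.mpr hy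
  have h : HasFDerivAt (gHelm k) _ y :=
    (hasDerivAt_helmholtz_radial k hy').hasFDerivAt.comp y (hasFDerivAt_norm_of_ne_zero hy)
  have hr' : (‖y‖ : ℂ) ≠ 0 := Complex.ofReal_ne_zero.mpr hy'
  have hπ : (π : ℂ) ≠ 0 := Complex.ofReal_ne_zero.mpr pi_ne_zero
  rw [h.fderiv]
  simp
  field_simp

theorem norm_one_sub_exp_mul_le (t : ℝ) :
    ‖1 - Complex.exp (-Complex.I * t) * (1 + Complex.I * t)‖ ≤ 2 * |t| := by
  have hexp : -Complex.I * (t : ℂ) = Complex.I * ((-t : ℝ) : ℂ) := by push_cast; ring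
  have hsub := Real.norm_exp_I_mul_ofReal_sub_one_le (x := -t)
  have hnorm : ‖Complex.exp (Complex.I * ((-t : ℝ) : ℂ))‖ = 1 :=
    Complex.norm_exp_I_mul_ofReal _
  rw [norm_neg, Real.norm_eq_abs] at hsub
  rw [hexp]
  set e := Complex.exp (Complex.I * ((-t : ℝ) : ℂ))
  calc ‖1 - e * (1 + Complex.I * t)‖ = ‖-(e - 1) - e * (Complex.I * t)‖ := by ring_nf
    _ ≤ ‖-(e - 1)‖ + ‖e * (Complex.I * t)‖ := norm_sub_le _ _
    _ = ‖e - 1‖ + |t| := by rw [norm_neg]; simp [hnorm]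
    _ ≤ 2 * |t| := by linarith

theorem gradient_helmholtz_leading_singularity (k : ℝ) :
    ∃ C : ℝ, 0 < C ∧
      ∀ y : EuclideanSpace ℝ (Fin 3), 0 < ‖y‖ → ‖y‖ ≤ 1 →
        ∀ v : EuclideanSpace ℝ (Fin 3),
          ‖fderiv ℝ (gHelm k) y v + ((⟪y, v⟫ / (4 * π * ‖y‖ ^ 3) : ℝ) : ℂ)‖ ≤
            C * ‖v‖ / ‖y‖ := by
  refine ⟨2 * |k| / (4 * π) + 1, by positivity, fun y hy _ v => ?_⟩
  have hrest := norm_one_sub_exp_mul_le (k * ‖y‖)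
  rw [abs_mul, abs_norm] at hrest
  push_cast at hrest
  simp only [← mul_assoc] at hrest
  have hinner : ‖((⟪y, v⟫ / (4 * π * ‖y‖ ^ 3) : ℝ) : ℂ)‖ ≤ ‖y‖ * ‖v‖ / (4 * π * ‖y‖ ^ 3) := by
    rw [Complex.norm_real, norm_div, Real.norm_of_nonneg (by positivity : 0 ≤ 4 * π * ‖y‖ ^ 3)]
    gcongr
    exact norm_inner_le_norm y v
  rw [fderiv_gHelm_apply k (norm_pos_iff.mp hy)]
  set a := ((⟪y, v⟫ / (4 * π * ‖y‖ ^ 3) : ℝ) : ℂ)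
  set w := Complex.exp (-Complex.I * k * ‖y‖) * (1 + Complex.I * k * ‖y‖)
  calc ‖-(a * w) + a‖ = ‖a‖ * ‖1 - w‖ := by rw [← norm_mul]; ring_nf
    _ ≤ ‖y‖ * ‖v‖ / (4 * π * ‖y‖ ^ 3) * (2 * |k| * ‖y‖) := by gcongr
    _ = 2 * |k| / (4 * π) * ‖v‖ / ‖y‖ := by field_simp
    _ ≤ (2 * |k| / (4 * π) + 1) * ‖v‖ / ‖y‖ := by gcongr; linarith
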